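/- Let N ≥ 1, let A, X, B, Y be finite nonempty types, let d ≥ 1, and let σ : (Fin N → A) → (Fin N → X) → Matrix (Fin d) (Fin d) ℂ be a non-signalling assemblage: each σ a⃗ x⃗ is positive semidefinite, ∑_{a_k} σ a⃗ x⃗ (summed over the k-th outcome with all other outcomes fixed) is independent of x⃗ k for every party k, and trace(∑_{a⃗} σ a⃗ x⃗) = 1 for all x⃗. Let Q : Y → B → Matrix (Fin d) (Fin d) ℂ be a family of Hermitian idempotents with ∑_b Q y b = 1 for all y, whose ℂ-linear span is all of Matrix (Fin d) (Fin d) ℂ (a tomographically complete projective measurement set). Assume the correlation p(a⃗, b | x⃗, y) := trace((Q y b) * (σ a⃗ x⃗)) admits an almost-quantum realisation on a factorised Hilbert space with Bob's measurements acting only on his factor: there exist n ≥ 1, a unit vector ψ : Fin n × Fin d → ℂ, and families E : Fin N → X → A → Matrix (Fin n × Fin d) (Fin n × Fin d) ℂ of Hermitian idempotents with ∑_a E i x a = 1, such that, writing E(a⃗,x⃗) := ∏_i E i (x⃗ i) (a⃗ i) in the order i = 0,…,N−1 and G y b := 1 ⊗ₖ (Q y b): (i) p(a⃗, b | x⃗,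 y) = star ψ ⬝ᵥ ((E(a⃗,x⃗) * G y b) *ᵥ ψ); (ii) G y b * E i x a = E i x a * G y b for all i, x, a, y, b; and (iii) for every permutation π of Fin N, (E_π(a⃗,x⃗) * G y b) *ᵥ ψ = (E(a⃗,x⃗) * G y b) *ᵥ ψ, where E_π is the product in the order π(0),…,π(N−1). Then σ is an almost-quantum assemblage: there exists a positive semidefinite matrix Γ : Matrix (W × Fin d) (W × Fin d) ℂ, where W := Fin N → Option (A × X), such that, writing Γ[v,w] for the d × d block Γ[v,w] i j = Γ (v,i) (w,j) and ε : W for the constant-none word: (a) trace(Γ[ε,ε]) = 1; (b) Γ[v,w] = 0 whenever the pair (v,w) is null; (c) Γ[v,w] = Γ[v',w'] whenever (v,w) ≡ (v',w'); (d) Γ[ε,ε] = ∑_{a⃗} σ a⃗ x⃗ (for any x⃗); and (e) for every word w : W and every a⃗, x⃗ compatible with w (i.e. w k = some (a⃗ k, x⃗ k) whenever w k ≠ none), Γ[ε, w] = ∑_{a_k for the parties k with w k = none} σ a⃗ x⃗, the marginal assemblage element on the support of w. -/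

import Mathlib

open scoped Kronecker ComplexOrder
open Matrix

/-- The ordered product `F 0 * F 1 * ⋯ * F (N-1)` of a family of square matrices. -/
noncomputable def ordProd {N : ℕ} {I : Type} [Fintype I] [DecidableEq I]
    (F : Fin N → Matrix I I ℂ) : Matrix I I ℂ :=
  (List.ofFn F).prod

/-- Reduction of a pair of per-party letters: `red (v k) (w k)` records the per-party
content of the word `v†w`, being `none` exactly when the word is null at party `k`. -/
def red {A X : Type} [DecidableEq A] [DecidableEq X] :
    Option (A × X) → Option (A × X) → Option (List (A × X))
  | none, none => some []
  | some l, none => some [l]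
  | none, some l => some [l]
  | some l, some l' =>
      if l = l' then some [l] else if l.2 = l'.2 then none else some [l, l']

/-- The empty word of an `N`-party EPR scenario. -/
def emptyWord (N : ℕ) (A X : Type) : Fin N → Option (A × X) := fun _ => none

open scoped MatrixOrder in
/-- Hermitian idempotents summing to the identity are mutually orthogonal. -/
lemma hermitian_idempotents_mul_eq_zero {I A : Type} [Fintype I] [DecidableEq I] [Fintype A]
    [DecidableEq A] {P : A → Matrix I I ℂ} (hherm : ∀ a, (P a).IsHermitian)
    (hidem : ∀ a, P a * P a = P a) (hsum : ∑ a, P a = 1) {a a' : A} (h : a ≠ a') :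
    P a * P a' = 0 := by
  have key : ∀ c, P a' * P c * P a' = (P c * P a')ᴴ * (P c * P a') := fun c => by
    rw [conjTranspose_mul, (hherm c).eq, (hherm a').eq, Matrix.mul_assoc, Matrix.mul_assoc,
      ← Matrix.mul_assoc (P c), hidem]
  have hall : ∑ c, P a' * P c * P a' = P a' := by
    rw [← Finset.sum_mul, ← Finset.mul_sum, hsum, mul_one, hidem]
  have hzero : ∑ c ∈ Finset.univ.erase a', (P c * P a')ᴴ * (P c * P a') = 0 := by
    rw [← Finset.add_sum_erase _ _ (Finset.mem_univ a'), hidem, hidem] at hall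
    simpa only [key, add_eq_left] using hall
  rw [Finset.sum_eq_zero_iff_of_nonneg
    fun c _ => (posSemidef_conjTranspose_mul_self _).nonneg] at hzero
  exact conjTranspose_mul_self_eq_zero.mp (hzero a (by simp [h]))

lemma ordProd_sum {N : ℕ} {I A : Type} [Fintype I] [DecidableEq I]
    (S : Fin N → Finset A) (g : Fin N → A → Matrix I I ℂ) :
    ordProd (fun j => ∑ a ∈ S j, g j a) =
      ∑ r ∈ Fintype.piFinset S, ordProd (fun j => g j (r j)) := by
  have := (MultilinearMap.mkPiAlgebraFin ℂ N (Matrix I I ℂ)).map_sum_finset g S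
  simpa only [MultilinearMap.mkPiAlgebraFin_apply, ordProd] using this

lemma mulVec_dotProduct_star {I : Type} [Fintype I] {M : Matrix I I ℂ} (hM : M.IsHermitian)
    (u u' : I → ℂ) : (M *ᵥ u) ⬝ᵥ star u' = u ⬝ᵥ star (M *ᵥ u') := by
  rw [star_mulVec, hM.eq, dotProduct_comm, dotProduct_mulVec, dotProduct_comm]

lemma fill_eq_of_red_eq {A X : Type} [DecidableEq A] [DecidableEq X]
    {o p o' p' : Option (A × X)} (hne : red o p ≠ none)
    (h : red o p = red o' p') : (o <|> p) = (o' <|> p') ∧ (p <|> o) = (p' <|> o') := by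
  cases o <;> cases p <;> cases o' <;> cases p' <;> grind [red]

section Words

variable {N : ℕ} {A X I : Type} [DecidableEq I] {E : Fin N → X → A → Matrix I I ℂ} {ξ ξ' : I → ℂ}

/-- The operator of the letter contributed by party `k`, the identity if there is none. -/
def letterOp (E : Fin N → X → A → Matrix I I ℂ) (k : Fin N) : Option (A × X) → Matrix I I ℂ
  | none => 1
  | some l => E k l.2 l.1

lemma letterOp_eq_sum [Fintype A] (hsum : ∀ i x, ∑ a, E i x a = 1)
    {w : Fin N → Option (A × X)} {av : Fin N → A} {xv : Fin N → X}
    (h : ∀ k, w k ≠ none → w k = some (av k, xv k)) (k : Fin N) :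
    letterOp E k (w k) =
      ∑ a ∈ (if w k = none then Finset.univ else {av k}), E k (xv k) a := by
  by_cases hk : w k = none
  · simp [hk, letterOp, hsum]
  · rw [if_neg hk, h k hk, Finset.sum_singleton, letterOp]

variable [Fintype I]

/-- The vector obtained by applying the operator of the word `w` to `ξ`. -/
noncomputable def wordVec (E : Fin N → X → A → Matrix I I ℂ) (ξ : I → ℂ)
    (w : Fin N → Option (A × X)) : I → ℂ :=
  ordProd (fun k => letterOp E k (w k)) *ᵥ ξ

/-- On `ξ`, the order in which the parties' operators act is irrelevant. -/
def PermInvariant (E : Fin N → X → A → Matrix I I ℂ) (ξ : I → ℂ) : Prop :=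
  ∀ (π : Equiv.Perm (Fin N)) (av : Fin N → A) (xv : Fin N → X),
    ordProd (fun j => E (π j) (xv (π j)) (av (π j))) *ᵥ ξ =
      ordProd (fun i => E i (xv i) (av i)) *ᵥ ξ

lemma wordVec_eq_sum [Fintype A] [DecidableEq A] (hsum : ∀ i x, ∑ a, E i x a = 1)
    {w : Fin N → Option (A × X)} {av : Fin N → A} {xv : Fin N → X}
    (h : ∀ k, w k ≠ none → w k = some (av k, xv k)) :
    wordVec E ξ w = ∑ f ∈ Finset.univ.filter
      (fun f : Fin N → A => ∀ k, w k ≠ none → f k = av k),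
        ordProd (fun i => E i (xv i) (f i)) *ᵥ ξ := by
  have hS : Finset.univ.filter (fun f : Fin N → A => ∀ k, w k ≠ none → f k = av k) =
      Fintype.piFinset fun k => if w k = none then Finset.univ else {av k} := by
    ext f
    simp only [Finset.mem_filter, Finset.mem_univ, true_and, Fintype.mem_piFinset]
    refine forall_congr' fun k => ?_
    by_cases hk : w k = none <;> simp [hk]
  simp only [wordVec, letterOp_eq_sum hsum h, ordProd_sum, hS, sum_mulVec]

lemma exists_compatible [Nonempty A] [Nonempty X] (w : Fin N → Option (A × X)) :
    ∃ (av : Fin N → A) (xv : Fin N → X), ∀ k, w k ≠ none → w k = some (av k, xv k) := by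
  obtain ⟨l⟩ : Nonempty (A × X) := inferInstance
  refine ⟨fun k => ((w k).getD l).1, fun k => ((w k).getD l).2, fun k hk => ?_⟩
  obtain ⟨l', hl'⟩ := Option.ne_none_iff_exists'.mp hk
  simp [hl']

variable [Fintype A] [Nonempty A] [Nonempty X]

lemma PermInvariant.wordVec_eq (hξ : PermInvariant E ξ) (hsum : ∀ i x, ∑ a, E i x a = 1)
    (w : Fin N → Option (A × X)) (π : Equiv.Perm (Fin N)) :
    wordVec E ξ w = ordProd (fun j => letterOp E (π j) (w (π j))) *ᵥ ξ := by
  obtain ⟨av, xv, h⟩ := exists_compatible w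
  simp only [wordVec, letterOp_eq_sum hsum h, ordProd_sum, sum_mulVec]
  refine Finset.sum_equiv (π.symm.arrowCongr (Equiv.refl A)) (fun f => ?_) fun f _ => ?_
  · simp only [Fintype.mem_piFinset]
    exact ⟨fun hf j => by simpa using hf (π j), fun hf k => by simpa using hf (π.symm k)⟩
  · exact (hξ π f xv).symm

lemma PermInvariant.mulVec_wordVec_update_none (hξ : PermInvariant E ξ)
    (hsum : ∀ i x, ∑ a, E i x a = 1) (w : Fin N → Option (A × X)) (k : Fin N) (l : A × X) :
    E k l.2 l.1 *ᵥ wordVec E ξ (Function.update w k none) =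
      wordVec E ξ (Function.update w k (some l)) := by
  obtain _ | m := N
  · exact k.elim0
  have front : ∀ o : Option (A × X), wordVec E ξ (Function.update w k o) =
      letterOp E k o *ᵥ (List.ofFn fun j : Fin m =>
        letterOp E (Equiv.swap 0 k j.succ) (w (Equiv.swap 0 k j.succ))).prod *ᵥ ξ := fun o => by
    have hne : ∀ j : Fin m, Equiv.swap 0 k j.succ ≠ k := fun j hj =>
      Fin.succ_ne_zero j ((Equiv.swap 0 k).injective (hj.trans (Equiv.swap_apply_left 0 k).symm))
    rw [hξ.wordVec_eq hsum _ (Equiv.swap 0 k), ordProd, List.ofFn_succ, List.prod_cons,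
      mulVec_mulVec]
    simp [hne]
  rw [front, front]
  simp [letterOp]

lemma PermInvariant.mulVec_wordVec (hξ : PermInvariant E ξ) (hsum : ∀ i x, ∑ a, E i x a = 1)
    (hidem : ∀ i x a, E i x a * E i x a = E i x a) {w : Fin N → Option (A × X)} {k : Fin N}
    {l : A × X} (hw : w k = some l) : E k l.2 l.1 *ᵥ wordVec E ξ w = wordVec E ξ w := by
  have h := hξ.mulVec_wordVec_update_none hsum w k l
  rw [← hw, Function.update_eq_self] at h
  rw [← h, mulVec_mulVec, hidem]

lemma PermInvariant.dotProduct_fill_right (hξ : PermInvariant E ξ) (hξ' : PermInvariant E ξ')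
    (hsum : ∀ i x, ∑ a, E i x a = 1) (hidem : ∀ i x a, E i x a * E i x a = E i x a)
    (hherm : ∀ i x a, (E i x a).IsHermitian) (v w : Fin N → Option (A × X)) (k : Fin N) :
    wordVec E ξ v ⬝ᵥ star (wordVec E ξ' w) =
      wordVec E ξ v ⬝ᵥ star (wordVec E ξ' (Function.update w k (w k <|> v k))) := by
  rcases hw : w k with _ | l'
  · rcases hv : v k with _ | l
    · simp [← hw]
    · have h := hξ'.mulVec_wordVec_update_none hsum w k l
      rw [← hw, Function.update_eq_self] at h
      nth_rw 1 [← hξ.mulVec_wordVec hsum hidem hv]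
      rw [mulVec_dotProduct_star (hherm _ _ _), h]
      rfl
  · rw [show (some l' <|> v k) = w k from hw.symm, Function.update_eq_self]

lemma PermInvariant.dotProduct_fill_left (hξ : PermInvariant E ξ) (hξ' : PermInvariant E ξ')
    (hsum : ∀ i x, ∑ a, E i x a = 1) (hidem : ∀ i x a, E i x a * E i x a = E i x a)
    (hherm : ∀ i x a, (E i x a).IsHermitian) (v w : Fin N → Option (A × X)) (k : Fin N) :
    wordVec E ξ v ⬝ᵥ star (wordVec E ξ' w) =
      wordVec E ξ (Function.update v k (v k <|> w k)) ⬝ᵥ star (wordVec E ξ' w) := by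
  rw [dotProduct_star, hξ'.dotProduct_fill_right hξ hsum hidem hherm w v k, ← dotProduct_star]

lemma PermInvariant.dotProduct_fill (hξ : PermInvariant E ξ) (hξ' : PermInvariant E ξ')
    (hsum : ∀ i x, ∑ a, E i x a = 1) (hidem : ∀ i x a, E i x a * E i x a = E i x a)
    (hherm : ∀ i x a, (E i x a).IsHermitian) (v w : Fin N → Option (A × X)) :
    wordVec E ξ v ⬝ᵥ star (wordVec E ξ' w) =
      wordVec E ξ (fun k => v k <|> w k) ⬝ᵥ star (wordVec E ξ' (fun k => w k <|> v k)) := by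
  have main : ∀ S : Finset (Fin N), wordVec E ξ v ⬝ᵥ star (wordVec E ξ' w) =
      wordVec E ξ (fun k => if k ∈ S then (v k <|> w k) else v k) ⬝ᵥ
        star (wordVec E ξ' (fun k => if k ∈ S then (w k <|> v k) else w k)) := fun S => by
    induction S using Finset.induction_on with
    | empty => simp
    | insert k S hk ih =>
      rw [ih, hξ.dotProduct_fill_right hξ' hsum hidem hherm _ _ k,
        hξ.dotProduct_fill_left hξ' hsum hidem hherm _ _ k]
      congr 2
      · ext1 i
        rcases eq_or_ne i k with rfl | hi
        · simp only [hk, Function.update_self, Finset.mem_insert_self, if_true, if_false]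
          cases v i <;> cases w i <;> rfl
        · simp [hi]
      · congr 1
        ext1 i
        rcases eq_or_ne i k with rfl | hi
        · simp [hk]
        · simp [hi]
  simpa using main Finset.univ

variable [DecidableEq A] [DecidableEq X]

lemma PermInvariant.dotProduct_eq_zero (hξ : PermInvariant E ξ) (hξ' : PermInvariant E ξ')
    (hsum : ∀ i x, ∑ a, E i x a = 1) (hidem : ∀ i x a, E i x a * E i x a = E i x a)
    (hherm : ∀ i x a, (E i x a).IsHermitian) {v w : Fin N → Option (A × X)} {k : Fin N}
    (hk : red (v k) (w k) = none) :
    wordVec E ξ v ⬝ᵥ star (wordVec E ξ' w) = 0 := by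
  rcases hv : v k with _ | ⟨a, x⟩ <;> rcases hw : w k with _ | ⟨a', x'⟩ <;>
    simp only [hv, hw, red, reduceCtorEq] at hk
  split_ifs at hk with hne hx
  obtain rfl : x = x' := hx
  have ha : a ≠ a' := fun h => hne (by rw [h])
  rw [← hξ.mulVec_wordVec hsum hidem hv, ← hξ'.mulVec_wordVec hsum hidem hw,
    mulVec_dotProduct_star (hherm _ _ _), mulVec_mulVec,
    hermitian_idempotents_mul_eq_zero (hherm k x) (hidem k x) (hsum k x) ha]
  simp

lemma PermInvariant.dotProduct_congr (hξ : PermInvariant E ξ) (hξ' : PermInvariant E ξ')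
    (hsum : ∀ i x, ∑ a, E i x a = 1) (hidem : ∀ i x a, E i x a * E i x a = E i x a)
    (hherm : ∀ i x a, (E i x a).IsHermitian) {v w v' w' : Fin N → Option (A × X)}
    (h : ∀ k, red (v k) (w k) = red (v' k) (w' k)) :
    wordVec E ξ v ⬝ᵥ star (wordVec E ξ' w) = wordVec E ξ v' ⬝ᵥ star (wordVec E ξ' w') := by
  by_cases hnull : ∃ k, red (v k) (w k) = none
  · obtain ⟨k, hk⟩ := hnull
    rw [hξ.dotProduct_eq_zero hξ' hsum hidem hherm hk,
      hξ.dotProduct_eq_zero hξ' hsum hidem hherm ((h k).symm.trans hk)]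
  · push Not at hnull
    rw [hξ.dotProduct_fill hξ' hsum hidem hherm v w,
      hξ.dotProduct_fill hξ' hsum hidem hherm v' w']
    simp only [fun k => (fill_eq_of_red_eq (hnull k) (h k)).1,
      fun k => (fill_eq_of_red_eq (hnull k) (h k)).2]

end Words

/-- Two linear maps agreeing on the members of a spanning family agree everywhere. -/
lemma eq_of_span_uncurry_eq_top {Y B V V' : Type*} [AddCommGroup V] [Module ℂ V]
    [AddCommGroup V'] [Module ℂ V'] {Q : Y → B → V}
    (hQ : Submodule.span ℂ (Set.range (Function.uncurry Q)) = ⊤) {f g : V →ₗ[ℂ] V'}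
    (h : ∀ y b, f (Q y b) = g (Q y b)) (M : V) : f M = g M := by
  have : f = g := LinearMap.ext_on_range hQ fun p => h p.1 p.2
  rw [this]

lemma ordProd_commute {N : ℕ} {I : Type} [Fintype I] [DecidableEq I] {F : Fin N → Matrix I I ℂ}
    {M : Matrix I I ℂ} (h : ∀ i, Commute M (F i)) : Commute M (ordProd F) :=
  Commute.list_prod_right _ _ fun x hx => by
    obtain ⟨i, rfl⟩ := (List.mem_ofFn' F x).mp hx
    exact h i

/-- Proposition 2: if the correlation obtained from tomographically complete projective
measurements on a non-signalling assemblage is almost-quantum, realised on a factorised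
Hilbert space with Bob's measurements acting only on his factor, then the assemblage is
an almost-quantum assemblage. -/
theorem macroscopically_noncontextual_assemblage_is_almost_quantum
    {N : ℕ} (hN : 1 ≤ N)
    {A X B Y : Type} [Fintype A] [Nonempty A] [DecidableEq A]
    [Fintype X] [Nonempty X] [DecidableEq X]
    [Fintype B] [Nonempty B] [Fintype Y] [Nonempty Y]
    {d : ℕ} (hd : 1 ≤ d)
    (σ : (Fin N → A) → (Fin N → X) → Matrix (Fin d) (Fin d) ℂ)
    (hpos : ∀ av xv, (σ av xv).PosSemidef)
    (hNS : ∀ (k : Fin N) (av : Fin N → A) (xv : Fin N → X) (x' : X),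
      ∑ a : A, σ (Function.update av k a) xv =
        ∑ a : A, σ (Function.update av k a) (Function.update xv k x'))
    (hnorm : ∀ xv : Fin N → X, (∑ av : Fin N → A, σ av xv).trace = 1)
    (Q : Y → B → Matrix (Fin d) (Fin d) ℂ)
    (hQherm : ∀ y b, (Q y b).IsHermitian)
    (hQidem : ∀ y b, Q y b * Q y b = Q y b)
    (hQsum : ∀ y, ∑ b : B, Q y b = 1)
    (hQspan : Submodule.span ℂ (Set.range (Function.uncurry Q)) = ⊤)
    -- almost-quantum realisation of the correlations on a factorised Hilbert space,
    -- with Bob's measurements of the form 1 ⊗ Q y b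
    {n : ℕ} (hn : 1 ≤ n)
    (ψ : Fin n × Fin d → ℂ) (hψ : star ψ ⬝ᵥ ψ = 1)
    (E : Fin N → X → A → Matrix (Fin n × Fin d) (Fin n × Fin d) ℂ)
    (hEherm : ∀ i x a, (E i x a).IsHermitian)
    (hEidem : ∀ i x a, E i x a * E i x a = E i x a)
    (hEsum : ∀ i x, ∑ a : A, E i x a = 1)
    (hcorr : ∀ (av : Fin N → A) (xv : Fin N → X) (y : Y) (b : B),
      ((Q y b) * (σ av xv)).trace =
        star ψ ⬝ᵥ ((ordProd (fun i => E i (xv i) (av i)) *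
          ((1 : Matrix (Fin n) (Fin n) ℂ) ⊗ₖ Q y b)) *ᵥ ψ))
    (hcomm : ∀ (i : Fin N) (x : X) (a : A) (y : Y) (b : B),
      ((1 : Matrix (Fin n) (Fin n) ℂ) ⊗ₖ Q y b) * E i x a =
        E i x a * ((1 : Matrix (Fin n) (Fin n) ℂ) ⊗ₖ Q y b))
    (hperm : ∀ (π : Equiv.Perm (Fin N)) (av : Fin N → A) (xv : Fin N → X)
        (y : Y) (b : B),
      (ordProd (fun j => E (π j) (xv (π j)) (av (π j))) *
          ((1 : Matrix (Fin n) (Fin n) ℂ) ⊗ₖ Q y b)) *ᵥ ψ =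
        (ordProd (fun i => E i (xv i) (av i)) *
          ((1 : Matrix (Fin n) (Fin n) ℂ) ⊗ₖ Q y b)) *ᵥ ψ) :
    -- conclusion: σ is an almost-quantum assemblage
    ∃ Γ : Matrix ((Fin N → Option (A × X)) × Fin d)
        ((Fin N → Option (A × X)) × Fin d) ℂ,
      Γ.PosSemidef ∧
      (∑ i : Fin d, Γ (emptyWord N A X, i) (emptyWord N A X, i) = 1) ∧
      (∀ v w : Fin N → Option (A × X), (∃ k, red (v k) (w k) = none) →
        ∀ i j : Fin d, Γ (v, i) (w, j) = 0) ∧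
      (∀ v w v' w' : Fin N → Option (A × X),
        (∀ k, red (v k) (w k) = red (v' k) (w' k)) →
        ∀ i j : Fin d, Γ (v, i) (w, j) = Γ (v', i) (w', j)) ∧
      (∀ (xv : Fin N → X) (i j : Fin d),
        Γ (emptyWord N A X, i) (emptyWord N A X, j) = (∑ av : Fin N → A, σ av xv) i j) ∧
      (∀ (w : Fin N → Option (A × X)) (av : Fin N → A) (xv : Fin N → X),
        (∀ k, w k ≠ none → w k = some (av k, xv k)) →
        ∀ i j : Fin d,
          Γ (emptyWord N A X, i) (w, j) =
            (∑ f ∈ Finset.univ.filter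
                (fun f : Fin N → A => ∀ k, w k ≠ none → f k = av k),
              σ f xv) i j) := by
  let K : Matrix (Fin d) (Fin d) ℂ →ₗ[ℂ] Matrix (Fin n × Fin d) (Fin n × Fin d) ℂ :=
    kroneckerBilinear (R := ℂ) (1 : Matrix (Fin n) (Fin n) ℂ)
  have hK : ∀ M, K M = (1 : Matrix (Fin n) (Fin n) ℂ) ⊗ₖ M := fun _ => rfl
  have hKcomm : ∀ i x a M, Commute (K M) (E i x a) := fun i x a M =>
    eq_of_span_uncurry_eq_top hQspan (f := (LinearMap.mulRight ℂ (E i x a)).comp K)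
      (g := (LinearMap.mulLeft ℂ (E i x a)).comp K) (hcomm i x a) M
  have hKperm : ∀ M, PermInvariant E (K M *ᵥ ψ) := fun M π av xv => by
    have h := eq_of_span_uncurry_eq_top hQspan
      (f := ((mulVecBilin ℂ ℂ).flip ψ).comp ((LinearMap.mulLeft ℂ
        (ordProd fun j => E (π j) (xv (π j)) (av (π j)))).comp K))
      (g := ((mulVecBilin ℂ ℂ).flip ψ).comp ((LinearMap.mulLeft ℂ
        (ordProd fun i => E i (xv i) (av i))).comp K)) (hperm π av xv) M
    simpa [mulVec_mulVec] using h
  have hKcorr : ∀ av xv M, (M * σ av xv).trace =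
      star ψ ⬝ᵥ ((ordProd (fun i => E i (xv i) (av i)) * K M) *ᵥ ψ) := fun av xv M =>
    eq_of_span_uncurry_eq_top hQspan
      (f := (traceLinearMap (Fin d) ℂ ℂ).comp (LinearMap.mulRight ℂ (σ av xv)))
      (g := (dotProductBilin ℂ ℂ (star ψ)).comp (((mulVecBilin ℂ ℂ).flip ψ).comp
        ((LinearMap.mulLeft ℂ (ordProd fun i => E i (xv i) (av i))).comp K)))
      (hcorr av xv) M
  -- `ξ j` is `(1 ⊗ |0⟩⟨j|) ψ`
  let z : Fin d := ⟨0, hd⟩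
  let ξ : Fin d → Fin n × Fin d → ℂ := fun j => K (single z j 1) *ᵥ ψ
  have hσ : ∀ av xv i j, σ av xv i j =
      ξ i ⬝ᵥ star (ordProd (fun i => E i (xv i) (av i)) *ᵥ ξ j) := fun av xv i j => by
    have hconj : (K (single z i 1))ᴴ = K (single i z 1) := by
      simp [hK, conjTranspose_kronecker]
    have hmul : K (single i z 1) * K (single z j 1) = K (single i j 1) := by
      simp [hK, ← mul_kronecker_mul]
    have h := hKcorr av xv (single i j 1)
    rw [trace_single_mul, one_smul, ← hmul, ← Matrix.mul_assoc,
      ← (ordProd_commute fun k => hKcomm k _ _ _).eq, Matrix.mul_assoc, ← mulVec_mulVec,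
      dotProduct_mulVec, ← hconj, ← star_mulVec, ← mulVec_mulVec] at h
    rw [← (hpos av xv).isHermitian.apply, h, ← star_dotProduct_star, star_star, dotProduct_comm]
  let V : Matrix ((Fin N → Option (A × X)) × Fin d) (Fin n × Fin d) ℂ :=
    of fun p => wordVec E (ξ p.2) p.1
  have hV : ∀ v w i j, (V * Vᴴ) (v, i) (w, j) =
      wordVec E (ξ i) v ⬝ᵥ star (wordVec E (ξ j) w) := fun _ _ _ _ => rfl
  have hξ : ∀ j, PermInvariant E (ξ j) := fun j => hKperm _
  have hmarg : ∀ (w : Fin N → Option (A × X)) (av : Fin N → A) (xv : Fin N → X),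
      (∀ k, w k ≠ none → w k = some (av k, xv k)) → ∀ i j : Fin d,
        (V * Vᴴ) (emptyWord N A X, i) (w, j) = (∑ f ∈ Finset.univ.filter
          (fun f : Fin N → A => ∀ k, w k ≠ none → f k = av k), σ f xv) i j := by
    intro w av xv h i j
    have hempty : wordVec E (ξ i) (emptyWord N A X) = ξ i := by
      simp [wordVec, emptyWord, letterOp, ordProd]
    rw [hV, hempty, wordVec_eq_sum hEsum h, star_sum, dotProduct_sum, Matrix.sum_apply]
    exact Finset.sum_congr rfl fun f _ => (hσ f xv i j).symm
  have htotal : ∀ (xv : Fin N → X) (i j : Fin d),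
      (V * Vᴴ) (emptyWord N A X, i) (emptyWord N A X, j) = (∑ av, σ av xv) i j := by
    intro xv i j
    rw [hmarg (emptyWord N A X) (Classical.arbitrary _) xv (by simp [emptyWord]) i j]
    simp [emptyWord]
  refine ⟨V * Vᴴ, posSemidef_self_mul_conjTranspose V, ?_, ?_, ?_, htotal, hmarg⟩
  · simp only [htotal (Classical.arbitrary _)]
    exact hnorm _
  · rintro v w ⟨k, hk⟩ i j
    exact (hξ i).dotProduct_eq_zero (hξ j) hEsum hEidem hEherm hk
  · intro v w v' w' h i j
    exact (hξ i).dotProduct_congr (hξ j) hEsum hEidem hEherm h
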